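/- arXiv:2111.03030 — 6 statements merged into one kernel-verified Lean document; each statement's English description precedes it below -/
import Mathlib

section
/- (Nonnegative Factorization of Rank-k Matrices) Given a symmetric matrix L ∈ ℝ^{n×n} of rank k, there exist entrywise nonnegative matrices B ∈ ℝ₊^{n×k_B} and C ∈ ℝ₊^{n×k_C} with k_B + k_C = 3k such that B Bᵀ − C Cᵀ = L. -/
open Matrix

/-- `L` is a difference of Gram matrices of two entrywise nonnegative matrices having `m` columns
in total. -/
def HasNonnegFactorization {n : ℕ} (m : ℕ) (L : Matrix (Fin n) (Fin n) ℝ) : Prop :=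
  ∃ (kB kC : ℕ) (B : Matrix (Fin n) (Fin kB) ℝ) (C : Matrix (Fin n) (Fin kC) ℝ),
    kB + kC = m ∧ (∀ i j, 0 ≤ B i j) ∧ (∀ i j, 0 ≤ C i j) ∧ B * Bᵀ - C * Cᵀ = L

theorem Fin.append_nonneg {a b : ℕ} {x : Fin a → ℝ} {y : Fin b → ℝ} (hx : ∀ i, 0 ≤ x i)
    (hy : ∀ i, 0 ≤ y i) (j : Fin (a + b)) : 0 ≤ Fin.append x y j := by
  induction j using Fin.addCases <;> simp [hx, hy]

namespace HasNonnegFactorization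

variable {n m m' : ℕ} {L L' : Matrix (Fin n) (Fin n) ℝ}

theorem zero : HasNonnegFactorization 0 (0 : Matrix (Fin n) (Fin n) ℝ) :=
  ⟨0, 0, 0, 0, rfl, fun _ _ => le_rfl, fun _ _ => le_rfl, by simp⟩

theorem neg (h : HasNonnegFactorization m L) : HasNonnegFactorization m (-L) := by
  obtain ⟨kB, kC, B, C, hk, hB, hC, rfl⟩ := h
  exact ⟨kC, kB, C, B, by omega, hC, hB, by simp⟩

theorem add (h : HasNonnegFactorization m L) (h' : HasNonnegFactorization m' L') :
    HasNonnegFactorization (m + m') (L + L') := by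
  obtain ⟨kB, kC, B, C, hk, hB, hC, rfl⟩ := h
  obtain ⟨kB', kC', B', C', hk', hB', hC', rfl⟩ := h'
  refine ⟨kB + kB', kC + kC', of fun i => Fin.append (B i) (B' i),
    of fun i => Fin.append (C i) (C' i), by omega,
    fun i => Fin.append_nonneg (hB i) (hB' i), fun i => Fin.append_nonneg (hC i) (hC' i), ?_⟩
  ext i j
  simp only [Matrix.sub_apply, Matrix.add_apply, mul_apply, transpose_apply, of_apply, Fin.sum_univ_add,
    Fin.append_left, Fin.append_right]
  ring

theorem sum {ι : Type*} (s : Finset ι) {f : ι → Matrix (Fin n) (Fin n) ℝ}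
    (h : ∀ i ∈ s, HasNonnegFactorization m (f i)) :
    HasNonnegFactorization (m * s.card) (∑ i ∈ s, f i) := by
  classical
  induction s using Finset.induction_on with
  | empty => simpa using zero
  | insert a s ha ih =>
    rw [Finset.sum_insert ha, Finset.card_insert_of_notMem ha, mul_add, mul_one, add_comm (m * _)]
    exact (h a (by simp)).add (ih fun i hi => h i (by simp [hi]))

/-- With `v = v⁺ - v⁻`, we have `v vᵀ = 2 v⁺ v⁺ᵀ + 2 v⁻ v⁻ᵀ - |v| |v|ᵀ`. -/
theorem vecMulVec_self (v : Fin n → ℝ) : HasNonnegFactorization 3 (vecMulVec v v) := by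
  refine ⟨2, 1, of fun i => ![√2 * (v i)⁺, √2 * (v i)⁻], of fun i _ => |v i|, rfl, ?_, ?_, ?_⟩
  · intro i j
    fin_cases j <;> simp [posPart_nonneg, negPart_nonneg]
  · exact fun i _ => abs_nonneg _
  · ext i j
    have h2 : √2 * √2 = (2 : ℝ) := Real.mul_self_sqrt zero_le_two
    simp only [Matrix.sub_apply, mul_apply, transpose_apply, of_apply, Fin.sum_univ_two,
      vecMulVec_apply, cons_val_zero, cons_val_one, Finset.univ_unique, Finset.sum_singleton]
    simp only [← posPart_add_negPart]
    linear_combination ((v i)⁺ * (v j)⁺ + (v i)⁻ * (v j)⁻) * h2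
      + ((v i)⁺ - (v i)⁻) * posPart_sub_negPart (v j) + v j * posPart_sub_negPart (v i)

theorem smul_vecMulVec_self (c : ℝ) (v : Fin n → ℝ) :
    HasNonnegFactorization 3 (c • vecMulVec v v) := by
  have key {d : ℝ} (hd : 0 ≤ d) : HasNonnegFactorization 3 (d • vecMulVec v v) := by
    have h := vecMulVec_self (√d • v)
    rwa [smul_vecMulVec, vecMulVec_smul, smul_smul, Real.mul_self_sqrt hd] at h
  rcases le_total 0 c with hc | hc
  · exact key hc
  · simpa using (key (neg_nonneg.2 hc)).neg

end HasNonnegFactorization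

theorem Matrix.IsHermitian.eq_sum_eigenvalues_smul_vecMulVec {ι : Type*} [Fintype ι]
    [DecidableEq ι] {A : Matrix ι ι ℝ} (hA : A.IsHermitian) :
    A = ∑ l, hA.eigenvalues l • vecMulVec (hA.eigenvectorBasis l) (hA.eigenvectorBasis l) := by
  ext i j
  conv_lhs => rw [hA.spectral_theorem, Unitary.conjStarAlgAut_apply, mul_apply]
  simp only [mul_diagonal, star_apply, Matrix.sum_apply, Matrix.smul_apply, vecMulVec_apply,
    hA.eigenvectorUnitary_apply]
  refine Finset.sum_congr rfl fun l _ => ?_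
  simp
  ring

/-- **Nonnegative Factorization of Rank-k Matrices.** Given a symmetric rank-`k` matrix
`L ∈ ℝ^{n×n}`, there exist entrywise nonnegative matrices `B ∈ ℝ₊^{n×k_B}` and
`C ∈ ℝ₊^{n×k_C}` with `k_B + k_C = 3k` such that `B Bᵀ − C Cᵀ = L`. -/
theorem nonneg_factorization_of_rank (n k : ℕ) (L : Matrix (Fin n) (Fin n) ℝ)
    (hsymm : L.IsSymm) (hrank : L.rank = k) :
    ∃ (kB kC : ℕ) (B : Matrix (Fin n) (Fin kB) ℝ) (C : Matrix (Fin n) (Fin kC) ℝ),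
      kB + kC = 3 * k ∧ (∀ i j, 0 ≤ B i j) ∧ (∀ i j, 0 ≤ C i j) ∧
      B * Bᵀ - C * Cᵀ = L := by
  have hL : L.IsHermitian := isHermitian_iff_isSymm.2 hsymm
  have h := HasNonnegFactorization.sum (Finset.univ.filter fun l => hL.eigenvalues l ≠ 0)
    fun l _ => HasNonnegFactorization.smul_vecMulVec_self (hL.eigenvalues l)
      (hL.eigenvectorBasis l)
  rw [Finset.sum_filter_of_ne fun l _ hl => left_ne_zero_of_smul hl,
    ← hL.eq_sum_eigenvalues_smul_vecMulVec, ← Fintype.card_subtype,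
    ← hL.rank_eq_card_non_zero_eigs, hrank] at h
  exact h
end

section
/- (Exact LPCA Embeddings for Bounded-Degree Graphs) Let A ∈ {0,1}^{n×n} be the adjacency matrix of an undirected graph G with maximum degree c (i.e., A is symmetric with entries in {0,1} and every row of A has at most c nonzero entries). Then there exist matrices X, Y ∈ ℝ^{n×(2c+1)} such that for all i, j: (X Yᵀ)_{ij} > 0 if A_{ij} = 1, and (X Yᵀ)_{ij} < 0 if A_{ij} = 0. -/
open Matrix

/-- A real polynomial that is positive at the natural numbers in `s` and negative at all others. -/
noncomputable def separatingPolynomial (s : Finset ℕ) : Polynomial ℝ :=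
  Polynomial.C (1 / 2) - ∏ k ∈ s, (Polynomial.X - Polynomial.C (k : ℝ)) ^ 2

theorem natDegree_separatingPolynomial_le (s : Finset ℕ) :
    (separatingPolynomial s).natDegree ≤ 2 * s.card := by
  refine (Polynomial.natDegree_sub_le _ _).trans (max_le (by simp) ?_)
  refine (Polynomial.natDegree_prod_le _ _).trans ?_
  simp [mul_comm, -map_natCast]

theorem eval_separatingPolynomial (s : Finset ℕ) (m : ℕ) :
    (separatingPolynomial s).eval (m : ℝ) = 1 / 2 - ∏ k ∈ s, ((m : ℝ) - k) ^ 2 := by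
  simp [separatingPolynomial, Polynomial.eval_prod]

theorem eval_separatingPolynomial_pos {s : Finset ℕ} {m : ℕ} (hm : m ∈ s) :
    0 < (separatingPolynomial s).eval (m : ℝ) := by
  rw [eval_separatingPolynomial, Finset.prod_eq_zero hm (by simp)]
  norm_num

theorem eval_separatingPolynomial_neg {s : Finset ℕ} {m : ℕ} (hm : m ∉ s) :
    (separatingPolynomial s).eval (m : ℝ) < 0 := by
  have one_le : 1 ≤ ∏ k ∈ s, ((m : ℝ) - k) ^ 2 := by
    refine Finset.one_le_prod fun k hk => ?_
    have hne : (m : ℤ) - k ≠ 0 := by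
      rw [sub_ne_zero]
      exact_mod_cast fun h : m = k => hm (h ▸ hk)
    have h : 1 ≤ ((m : ℤ) - k) ^ 2 := Int.add_one_le_of_lt (sq_pos_of_ne_zero hne)
    exact_mod_cast h
  rw [eval_separatingPolynomial]
  linarith

/-- **Exact LPCA Embeddings for Bounded-Degree Graphs.** If `A ∈ {0,1}^{n×n}` is a
symmetric adjacency matrix with at most `c` ones per row, then there exist
`X, Y ∈ ℝ^{n×(2c+1)}` with `(X Yᵀ)_{ij} > 0` whenever `A_{ij} = 1` and
`(X Yᵀ)_{ij} < 0` whenever `A_{ij} = 0`. -/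
theorem exact_lpca_bounded_degree (n c : ℕ) (A : Matrix (Fin n) (Fin n) ℝ)
    (hsymm : A.IsSymm) (h01 : ∀ i j, A i j = 0 ∨ A i j = 1)
    (hdeg : ∀ i, {j | A i j = 1}.toFinset.card ≤ c) :
    ∃ X Y : Matrix (Fin n) (Fin (2 * c + 1)) ℝ,
      ∀ i j, (A i j = 1 → 0 < (X * Yᵀ) i j) ∧ (A i j = 0 → (X * Yᵀ) i j < 0) := by
  classical
  let S : Fin n → Finset (Fin n) := fun i => {j | A i j = 1}.toFinset
  have mem_S (i j) : j ∈ S i ↔ A i j = 1 := by simp [S]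
  let p : Fin n → Polynomial ℝ := fun i => separatingPolynomial ((S i).map Fin.valEmbedding)
  have natDegree_p (i) : (p i).natDegree < 2 * c + 1 := by
    have h := natDegree_separatingPolynomial_le ((S i).map Fin.valEmbedding)
    rw [Finset.card_map] at h
    have hc : (S i).card ≤ c := by convert hdeg i
    change (separatingPolynomial _).natDegree < _
    omega
  refine ⟨.of fun i k => (p i).coeff k, .of fun j k => (j : ℝ) ^ (k : ℕ), fun i j => ?_⟩
  have entry : ((Matrix.of fun i (k : Fin (2 * c + 1)) => (p i).coeff k) *
      (Matrix.of fun (j : Fin n) (k : Fin (2 * c + 1)) => (j : ℝ) ^ (k : ℕ))ᵀ) i j =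
      (p i).eval ((j : ℕ) : ℝ) := by
    rw [Polynomial.eval_eq_sum_range' (natDegree_p i), Finset.sum_range]
    simp [Matrix.mul_apply]
  rw [entry]
  refine ⟨fun h => ?_, fun h => ?_⟩
  · apply eval_separatingPolynomial_pos
    simpa [Fin.val_inj] using (mem_S i j).2 h
  · apply eval_separatingPolynomial_neg
    have hj : j ∉ S i := by simp [mem_S, h]
    simpa [Fin.val_inj] using hj
end

section
/- (Interpretable Exact Reconstruction for Bounded-Degree Graphs) Let A ∈ {0,1}^{n×n} be the adjacency matrix of an undirected graph G with maximum degree c, and let k = 12c + 6. For any ε > 0, there exist a matrix V ∈ [0,1]^{n×k} and a diagonal matrix W ∈ ℝ^{k×k} such that ‖σ(V W Vᵀ) − A‖_F < ε, where σ is the logistic function applied entrywise and ‖·‖_F is the Frobenius norm. -/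
open Matrix

/-- A symmetric product `P Xᵀ + X Pᵀ` is diagonalised by six nonnegative columns per column of `X`
when `|P| ≤ X` up to scaling; the columns can be normalised to have entries in `[0, 1]`. -/
theorem exists_unitInterval_diagonal_factorization {n d k : ℕ} (e : Fin k ≃ Fin d × Fin 6)
    (P X : Fin n → Fin d → ℝ) (hX : ∀ i m, 1 ≤ X i m) :
    ∃ (V : Matrix (Fin n) (Fin k) ℝ) (w : Fin k → ℝ), (∀ i j, V i j ∈ Set.Icc (0 : ℝ) 1) ∧
      ∀ i j, (V * diagonal w * Vᵀ) i j = ∑ m, (P i m * X j m + P j m * X i m) := by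
  obtain ⟨C, hC⟩ := (Set.finite_range fun q : Fin n × Fin d => |P q.1 q.2|).bddAbove
  obtain ⟨B, hB⟩ := (Set.finite_range fun q : Fin n × Fin d => X q.1 q.2).bddAbove
  obtain ⟨D, hD0, hD⟩ : ∃ D : ℝ, 0 < D ∧ ∀ i m, |P i m / D| ≤ 1 := by
    refine ⟨|C| + 1, by positivity, fun i m => ?_⟩
    have h : |P i m| ≤ C := hC ⟨(i, m), rfl⟩
    rw [abs_div, abs_of_pos (by positivity : 0 < |C| + 1), div_le_one (by positivity)]
    linarith [le_abs_self C]
  obtain ⟨E, hE0, hE⟩ : ∃ E : ℝ, 0 < E ∧ ∀ i m, X i m + 1 ≤ E := by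
    refine ⟨|B| + 1, by positivity, fun i m => ?_⟩
    have h : X i m ≤ B := hB ⟨(i, m), rfl⟩
    linarith [le_abs_self B]
  let s : Fin 6 → ℝ := ![1, -1, 0, 0, 0, 0]
  have hs : ∀ r, |s r| ≤ 1 := by
    intro r
    fin_cases r <;> simp [s]
  refine ⟨Matrix.of fun i a => (X i (e a).1 + s (e a).2 * (P i (e a).1 / D)) / E,
    fun a => s (e a).2 * (D * E ^ 2 / 2), fun i a => ?_, fun i j => ?_⟩
  · have h : |s (e a).2 * (P i (e a).1 / D)| ≤ 1 := by
      rw [abs_mul]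
      exact mul_le_one₀ (hs _) (abs_nonneg _) (hD _ _)
    have h' := abs_le.1 h
    have h1 := hX i (e a).1
    have h2 := hE i (e a).1
    rw [of_apply]
    exact ⟨div_nonneg (by linarith) hE0.le, (div_le_one hE0).2 (by linarith)⟩
  · rw [Matrix.mul_apply]
    simp only [mul_diagonal, transpose_apply, of_apply]
    rw [e.sum_comp fun b : Fin d × Fin 6 => (X i b.1 + s b.2 * (P i b.1 / D)) / E *
      (s b.2 * (D * E ^ 2 / 2)) * ((X j b.1 + s b.2 * (P j b.1 / D)) / E),
      Fintype.sum_prod_type]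
    refine Finset.sum_congr rfl fun m _ => ?_
    simp only [Fin.sum_univ_six, s]
    simp
    field_simp
    ring

/-- A polynomial of degree at most `2 * s.card` that is `1 / 2` at the points of `s` and at most
`-1 / 2` at all other integers. -/
theorem exists_polynomial_separating (s : Finset ℤ) :
    ∃ p : Polynomial ℝ, p.natDegree ≤ 2 * s.card ∧ (∀ z ∈ s, p.eval (z : ℝ) = 1 / 2) ∧
      ∀ z ∉ s, p.eval (z : ℝ) ≤ -1 / 2 := by
  refine ⟨Polynomial.C (1 / 2) -
    (∏ a ∈ s, (Polynomial.X - Polynomial.C (a : ℝ))) ^ 2, ?_, fun z hz => ?_, fun z hz => ?_⟩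
  · refine (Polynomial.natDegree_sub_le _ _).trans ?_
    rw [Polynomial.natDegree_C, Polynomial.natDegree_pow,
      Polynomial.natDegree_finsetProd_X_sub_C_eq_card]
    simp
  · simp [Polynomial.eval_prod, Finset.prod_eq_zero hz]
  · have h : (∏ a ∈ s, (z - a)) ≠ 0 :=
      Finset.prod_ne_zero_iff.2 fun a ha h => hz (by rwa [sub_eq_zero.1 h])
    have h1 : 1 ≤ (∏ a ∈ s, (z - a)) ^ 2 := by
      have := sq_pos_of_ne_zero h
      lia
    have h2 : (1 : ℝ) ≤ (∏ a ∈ s, ((z : ℝ) - a)) ^ 2 := by exact_mod_cast h1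
    simp only [Polynomial.eval_sub, Polynomial.eval_C, Polynomial.eval_pow, Polynomial.eval_prod,
      Polynomial.eval_X]
    linarith

theorem abs_logistic_sub_le {a L x : ℝ} (ha : a = 0 ∧ x ≤ -L ∨ a = 1 ∧ L ≤ x) :
    |1 / (1 + Real.exp (-x)) - a| ≤ Real.exp (-L) := by
  have hx := Real.exp_pos (-x)
  rcases ha with ⟨rfl, h⟩ | ⟨rfl, h⟩
  · rw [sub_zero, abs_of_pos (by positivity)]
    calc 1 / (1 + Real.exp (-x)) ≤ 1 / Real.exp (-x) := by gcongr; linarith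
      _ = Real.exp x := by rw [Real.exp_neg, one_div, inv_inv]
      _ ≤ Real.exp (-L) := Real.exp_le_exp.2 h
  · have h1 : 1 / (1 + Real.exp (-x)) - 1 = -(Real.exp (-x) / (1 + Real.exp (-x))) := by
      field_simp
      ring
    rw [h1, abs_neg, abs_of_pos (by positivity)]
    calc Real.exp (-x) / (1 + Real.exp (-x)) ≤ Real.exp (-x) :=
          div_le_self hx.le (by linarith)
      _ ≤ Real.exp (-L) := Real.exp_le_exp.2 (by linarith)

/-- **Interpretable Exact Reconstruction for Bounded-Degree Graphs.** Let
`A ∈ {0,1}^{n×n}` be a symmetric adjacency matrix with at most `c` ones per row, and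
let `k = 12c + 6`. For any `ε > 0` there exist `V ∈ [0,1]^{n×k}` and a diagonal
`W ∈ ℝ^{k×k}` with `‖σ(V W Vᵀ) − A‖_F < ε`, where `σ` is the entrywise logistic
function. -/
theorem interpretable_exact_reconstruction (n c : ℕ) (A : Matrix (Fin n) (Fin n) ℝ)
    (hsymm : A.IsSymm) (h01 : ∀ i j, A i j = 0 ∨ A i j = 1)
    (hdeg : ∀ i, {j | A i j = 1}.toFinset.card ≤ c) :
    ∀ ε > (0 : ℝ),
      ∃ (V : Matrix (Fin n) (Fin (12 * c + 6)) ℝ)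
        (W : Matrix (Fin (12 * c + 6)) (Fin (12 * c + 6)) ℝ),
        (∀ i j, V i j ∈ Set.Icc (0 : ℝ) 1) ∧ W.IsDiag ∧
        Real.sqrt (∑ i, ∑ j,
          (1 / (1 + Real.exp (-((V * W * Vᵀ) i j))) - A i j) ^ 2) < ε := by
  intro ε hε
  let t : Fin n → ℤ := fun j => j + 1
  have ht : Function.Injective t := fun a b h => by
    simp only [t] at h
    exact Fin.ext (by lia)
  have ht1 : ∀ j, (1 : ℝ) ≤ t j := fun j => by simp [t]
  have hp : ∀ i, ∃ p : Polynomial ℝ, p.natDegree < 2 * c + 1 ∧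
      (∀ j, A i j = 1 → p.eval (t j : ℝ) = 1 / 2) ∧
      ∀ j, A i j ≠ 1 → p.eval (t j : ℝ) ≤ -1 / 2 := by
    intro i
    obtain ⟨p, hdegree, hmem, hnot⟩ :=
      exists_polynomial_separating ({j | A i j = 1}.toFinset.image t)
    rw [Finset.card_image_of_injective _ ht] at hdegree
    refine ⟨p, by have := hdeg i; lia, fun j hj => hmem _ ?_, fun j hj => hnot _ ?_⟩
    · exact Finset.mem_image_of_mem _ (by simpa using hj)
    · rw [ht.mem_finset_image]
      simpa using hj
  choose p hdegree hadj hnadj using hp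
  have heval : ∀ i j, (p i).eval (t j : ℝ) =
      ∑ m : Fin (2 * c + 1), (p i).coeff m * (t j : ℝ) ^ (m : ℕ) := fun i j => by
    rw [Polynomial.eval_eq_sum_range' (hdegree i), Finset.sum_range]
  let e : Fin (12 * c + 6) ≃ Fin (2 * c + 1) × Fin 6 :=
    (finCongr (by ring)).trans finProdFinEquiv.symm
  set L : ℝ := n / ε with hL
  have hL0 : 0 ≤ L := by positivity
  obtain ⟨V, w, hV, hM⟩ := exists_unitInterval_diagonal_factorization e
    (fun i m => L * (p i).coeff m) (fun i m => (t i : ℝ) ^ (m : ℕ))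
    fun i m => one_le_pow₀ (ht1 i)
  refine ⟨V, diagonal w, hV, isDiag_diagonal w, ?_⟩
  have hM' : ∀ i j, (V * diagonal w * Vᵀ) i j =
      L * ((p i).eval (t j : ℝ) + (p j).eval (t i : ℝ)) := fun i j => by
    rw [hM, heval, heval, Finset.sum_add_distrib, mul_add, Finset.mul_sum, Finset.mul_sum]
    simp only [mul_assoc]
  have hentry : ∀ i j, (1 / (1 + Real.exp (-((V * diagonal w * Vᵀ) i j))) - A i j) ^ 2 ≤
      Real.exp (-L) ^ 2 := by
    intro i j
    refine sq_le_sq' (neg_le_of_abs_le ?_) (le_of_abs_le ?_) <;>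
    · refine abs_logistic_sub_le ?_
      rw [hM']
      have hji : A j i = A i j := hsymm.apply i j
      rcases h01 i j with h | h
      · have h1 := hnadj i j (by simp [h])
        have h2 := hnadj j i (by simp [hji, h])
        exact Or.inl ⟨h, by nlinarith⟩
      · have h1 := hadj i j h
        have h2 := hadj j i (hji.trans h)
        exact Or.inr ⟨h, by rw [h1, h2]; linarith⟩
  calc Real.sqrt _ ≤ Real.sqrt (∑ _i : Fin n, ∑ _j : Fin n, Real.exp (-L) ^ 2) :=
        Real.sqrt_le_sqrt (Finset.sum_le_sum fun i _ => Finset.sum_le_sum fun j _ => hentry i j)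
    _ = n * Real.exp (-L) := by
        rw [← Real.sqrt_sq (by positivity : 0 ≤ n * Real.exp (-L))]
        congr 1
        simp
        ring
    _ < ε := by
        rw [Real.exp_neg, ← div_eq_mul_inv, div_lt_iff₀ (Real.exp_pos L)]
        have h := Real.add_one_le_exp L
        have hn : (n : ℝ) = ε * L := by rw [hL]; field_simp
        nlinarith
end

section
/- Let A ∈ {0,1}^{n×n} be the adjacency matrix of an undirected graph with maximum degree c. Then there exist a matrix V ∈ [0,1]^{n×(12c+6)} and a diagonal matrix W ∈ ℝ^{(12c+6)×(12c+6)} such that for all i, j: (V W Vᵀ)_{ij} > 0 if A_{ij} = 1 and (V W Vᵀ)_{ij} < 0 if A_{ij} = 0. -/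
open Matrix

/-- A real symmetric rank-one matrix is a weighted sum of three symmetric rank-one matrices whose
vectors have entries in `[0,1]`. -/
theorem exists_rankOne_eq_sum_three {α : Type*} [Finite α] (u : α → ℝ) :
    ∃ (v : Fin 3 → α → ℝ) (w : Fin 3 → ℝ), (∀ t i, v t i ∈ Set.Icc (0 : ℝ) 1) ∧
      ∀ i j, u i * u j = ∑ t, w t * (v t i * v t j) := by
  obtain ⟨B, hB⟩ := (Set.finite_range fun i => |u i|).bddAbove
  set K : ℝ := max B 1 with hK
  have hK0 : 0 < K := lt_of_lt_of_le one_pos (le_max_right _ _)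
  have hu (i : α) : -K ≤ u i ∧ u i ≤ K :=
    abs_le.mp ((hB ⟨i, rfl⟩).trans (le_max_left _ _))
  set a : α → ℝ := fun i => (u i / K + 1) / 2 with ha
  have ha0 (i : α) : 0 ≤ a i := by
    have : -1 ≤ u i / K := by rw [le_div_iff₀ hK0]; linarith [(hu i).1]
    simp only [ha]; linarith
  have ha1 (i : α) : a i ≤ 1 := by
    have : u i / K ≤ 1 := by rw [div_le_iff₀ hK0]; linarith [(hu i).2]
    simp only [ha]; linarith
  have hua (i : α) : u i = K * (2 * a i - 1) := by
    simp only [ha]; field_simp; ring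
  refine ⟨![a, fun _ => 1, fun i => (a i + 1) / 2], ![6 * K ^ 2, 3 * K ^ 2, -8 * K ^ 2], ?_, ?_⟩
  · intro t i
    have h0 := ha0 i
    have h1 := ha1 i
    fin_cases t
    · exact ⟨h0, h1⟩
    · exact ⟨zero_le_one, le_rfl⟩
    · constructor
      · change 0 ≤ (a i + 1) / 2
        linarith
      · change (a i + 1) / 2 ≤ 1
        linarith
  · intro i j
    rw [hua i, hua j, Fin.sum_univ_three]
    simp only [Matrix.cons_val]
    ring

/-- A weighted sum of `r` real symmetric rank-one matrices factors as `V W Vᵀ` with `V` having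
`3 r` columns and entries in `[0,1]`, and `W` diagonal. -/
theorem exists_vwv_eq_sum_rankOne {α ι : Type*} [Finite α] [Fintype ι] {m : ℕ}
    (hm : Fintype.card ι * 3 = m) (a : ι → ℝ) (u : ι → α → ℝ) :
    ∃ (V : Matrix α (Fin m) ℝ) (W : Matrix (Fin m) (Fin m) ℝ),
      (∀ i j, V i j ∈ Set.Icc (0 : ℝ) 1) ∧ W.IsDiag ∧
      ∀ i j, (V * W * Vᵀ) i j = ∑ k, a k * (u k i * u k j) := by
  choose v w hv hvw using fun k => exists_rankOne_eq_sum_three (u k)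
  have e : Fin m ≃ ι × Fin 3 := (Fintype.equivFinOfCardEq (by simp [hm])).symm
  refine ⟨Matrix.of fun i s => v (e s).1 (e s).2 i,
    Matrix.diagonal fun s => a (e s).1 * w (e s).1 (e s).2, fun i s => hv _ _ _,
    Matrix.isDiag_diagonal _, fun i j => ?_⟩
  rw [Matrix.mul_apply]
  simp only [Matrix.mul_diagonal, Matrix.transpose_apply, Matrix.of_apply]
  rw [e.sum_comp fun q : ι × Fin 3 => v q.1 q.2 i * (a q.1 * w q.1 q.2) * v q.1 q.2 j,
    Fintype.sum_prod_type]
  refine Finset.sum_congr rfl fun k _ => ?_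
  rw [hvw, Finset.mul_sum]
  exact Finset.sum_congr rfl fun t _ => by ring

/-- For a set `S` of at most `c` natural numbers there is a real polynomial of degree at most `2 c`
which, on the natural numbers, is positive on `S` and negative off `S`. -/
theorem exists_polynomial_sign_pattern (S : Finset ℕ) {c : ℕ} (hS : S.card ≤ c) :
    ∃ p : Polynomial ℝ, p.natDegree < 2 * c + 1 ∧
      ∀ j : ℕ, (j ∈ S → 0 < p.eval (j : ℝ)) ∧ (j ∉ S → p.eval (j : ℝ) < 0) := by
  refine ⟨Polynomial.C (1 / 2) -
    ∏ s ∈ S, (Polynomial.X - Polynomial.C (s : ℝ)) ^ 2, ?_, fun j => ⟨fun hj => ?_, fun hj => ?_⟩⟩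
  · refine Nat.lt_succ_of_le ((Polynomial.natDegree_sub_le _ _).trans (max_le (by simp) ?_))
    refine (Polynomial.natDegree_prod_le _ _).trans ?_
    simp only [Polynomial.natDegree_pow, Polynomial.natDegree_X_sub_C, Finset.sum_const,
      smul_eq_mul]
    lia
  · rw [Polynomial.eval_sub, Polynomial.eval_prod, Finset.prod_eq_zero hj (by simp)]
    norm_num
  · have h1 : 1 ≤ ∏ s ∈ S, ((j : ℝ) - s) ^ 2 := by
      refine Finset.one_le_prod fun s hs => ?_
      have hne : (j : ℤ) - s ≠ 0 := by
        rw [sub_ne_zero]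
        exact_mod_cast fun h : j = s => hj (h ▸ hs)
      have : 1 ≤ ((j : ℤ) - s) ^ 2 := Int.add_one_le_iff.mpr (sq_pos_iff.mpr hne)
      exact_mod_cast this
    simp only [Polynomial.eval_sub, Polynomial.eval_prod, Polynomial.eval_pow, Polynomial.eval_X,
      Polynomial.eval_C]
    linarith

/-- Let `A ∈ {0,1}^{n×n}` be a symmetric adjacency matrix with at most `c` ones per
row. Then there exist `V ∈ [0,1]^{n×(12c+6)}` and a diagonal
`W ∈ ℝ^{(12c+6)×(12c+6)}` such that `(V W Vᵀ)_{ij} > 0` whenever `A_{ij} = 1` and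
`(V W Vᵀ)_{ij} < 0` whenever `A_{ij} = 0`. -/
theorem bounded_degree_vwv_signs (n c : ℕ) (A : Matrix (Fin n) (Fin n) ℝ)
    (hsymm : A.IsSymm) (h01 : ∀ i j, A i j = 0 ∨ A i j = 1)
    (hdeg : ∀ i, {j | A i j = 1}.toFinset.card ≤ c) :
    ∃ (V : Matrix (Fin n) (Fin (12 * c + 6)) ℝ)
      (W : Matrix (Fin (12 * c + 6)) (Fin (12 * c + 6)) ℝ),
      (∀ i j, V i j ∈ Set.Icc (0 : ℝ) 1) ∧ W.IsDiag ∧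
      ∀ i j, (A i j = 1 → 0 < (V * W * Vᵀ) i j) ∧ (A i j = 0 → (V * W * Vᵀ) i j < 0) := by
  classical
  choose p hp hsign using fun i => exists_polynomial_sign_pattern
    (({j | A i j = 1} : Set (Fin n)).toFinset.map Fin.valEmbedding)
    ((Finset.card_map _).trans_le (hdeg i))
  have hmem (i j : Fin n) :
      (j : ℕ) ∈ (({j | A i j = 1} : Set (Fin n)).toFinset.map Fin.valEmbedding) ↔ A i j = 1 := by
    simp [Fin.val_inj]
  have hpos (i j : Fin n) (h : A i j = 1) : 0 < (p i).eval ((j : ℕ) : ℝ) :=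
    (hsign i j).1 ((hmem i j).2 h)
  have hneg (i j : Fin n) (h : A i j = 0) : (p i).eval ((j : ℕ) : ℝ) < 0 :=
    (hsign i j).2 fun h' => by simp [(hmem i j).1 h'] at h
  let x (k : Fin (2 * c + 1)) (i : Fin n) : ℝ := (p i).coeff k
  let y (k : Fin (2 * c + 1)) (i : Fin n) : ℝ := ((i : ℕ) : ℝ) ^ (k : ℕ)
  obtain ⟨V, W, hV, hW, hVW⟩ := exists_vwv_eq_sum_rankOne
    (ι := Fin (2 * c + 1) × Bool) (m := 12 * c + 6) (by simp; ring)
    (fun q => if q.2 then 1 / 2 else -(1 / 2))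
    (fun q i => if q.2 then x q.1 i + y q.1 i else x q.1 i - y q.1 i)
  have key (i j : Fin n) :
      (V * W * Vᵀ) i j = (p i).eval ((j : ℕ) : ℝ) + (p j).eval ((i : ℕ) : ℝ) := by
    rw [hVW, Fintype.sum_prod_type, Polynomial.eval_eq_sum_range' (hp i),
      Polynomial.eval_eq_sum_range' (hp j), ← Finset.sum_add_distrib, Finset.sum_range]
    refine Finset.sum_congr rfl fun k _ => ?_
    simp only [Fintype.sum_bool, if_true, Bool.false_eq_true, if_false, x, y]
    ring
  refine ⟨V, W, hV, hW, fun i j => ⟨fun h => ?_, fun h => ?_⟩⟩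
  · rw [key]
    exact add_pos (hpos i j h) (hpos j i ((hsymm.apply i j).trans h))
  · rw [key]
    exact add_neg (hneg i j h) (hneg j i ((hsymm.apply i j).trans h))
end

section
/- Suppose there is an undirected, unweighted graph on n nodes with adjacency matrix A ∈ {0,1}^{n×n} whose edges are determined by an overlapping clustering and a thresholding integer t ∈ ℤ as follows: for each vertex i there are binary vectors b_i ∈ {0,1}^{k_b} and c_i ∈ {0,1}^{k_c}, and A_{ij} = 1 if and only if b_i · b_j − c_i · c_j ≥ t. Let k = k_b + k_c. Then for any ε > 0, there exist a matrix V ∈ [0,1]^{n×(k+1)} and a diagonal matrix W ∈ ℝ^{(k+1)×(k+1)} such that ‖σ(V W Vᵀ) − A‖_F < ε, where σ is the logistic function applied entrywise and ‖·‖_F is the Frobenius norm. -/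
open Matrix

open Filter Topology in
theorem tendsto_logistic_mul_of_pos {z : ℝ} (hz : 0 < z) :
    Tendsto (fun s : ℝ => 1 / (1 + Real.exp (-(s * z)))) atTop (𝓝 1) := by
  have h : Tendsto (fun s : ℝ => Real.exp (-(s * z))) atTop (𝓝 0) :=
    Real.tendsto_exp_neg_atTop_nhds_zero.comp (tendsto_id.atTop_mul_const hz)
  have h' : Tendsto (fun s : ℝ => 1 + Real.exp (-(s * z))) atTop (𝓝 1) := by
    simpa using h.const_add 1
  simpa using h'.inv₀ one_ne_zero

open Filter Topology in
theorem tendsto_logistic_mul_of_neg {z : ℝ} (hz : z < 0) :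
    Tendsto (fun s : ℝ => 1 / (1 + Real.exp (-(s * z)))) atTop (𝓝 0) := by
  have h : Tendsto (fun s : ℝ => Real.exp (-(s * z))) atTop atTop := by
    simp only [← mul_neg]
    exact Real.tendsto_exp_atTop.comp (tendsto_id.atTop_mul_const (neg_pos.mpr hz))
  exact (tendsto_const_nhds (x := (1 : ℝ))).div_atTop (tendsto_atTop_add_const_left _ 1 h)

theorem exists_int_sum_mul_eq {m : ℕ} {x y : Fin m → ℝ}
    (hx : ∀ l, x l = 0 ∨ x l = 1) (hy : ∀ l, y l = 0 ∨ y l = 1) :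
    ∃ d : ℤ, (d : ℝ) = ∑ l, x l * y l := by
  have h : ∀ l, ∃ d : ℤ, (d : ℝ) = x l * y l := by
    intro l
    rcases hx l with h | h <;> rcases hy l with h' | h' <;> rw [h, h']
    · exact ⟨0, by simp⟩
    · exact ⟨0, by simp⟩
    · exact ⟨0, by simp⟩
    · exact ⟨1, by simp⟩
  choose d hd using h
  exact ⟨∑ l, d l, by simp [hd]⟩

/-- Suppose the adjacency matrix `A ∈ {0,1}^{n×n}` is determined by binary vectors
`b_i ∈ {0,1}^{k_b}`, `c_i ∈ {0,1}^{k_c}` and a threshold `t ∈ ℤ` via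
`A_{ij} = 1 ↔ b_i · b_j − c_i · c_j ≥ t`. Let `k = k_b + k_c`. Then for any `ε > 0`
there exist `V ∈ [0,1]^{n×(k+1)}` and a diagonal `W ∈ ℝ^{(k+1)×(k+1)}` such that
`‖σ(V W Vᵀ) − A‖_F < ε`, with `σ` the entrywise logistic function. -/
theorem thresholded_clustering_reconstruction (n kb kc : ℕ) (t : ℤ)
    (A : Matrix (Fin n) (Fin n) ℝ)
    (b : Fin n → Fin kb → ℝ) (c : Fin n → Fin kc → ℝ)
    (hb : ∀ i l, b i l = 0 ∨ b i l = 1) (hc : ∀ i l, c i l = 0 ∨ c i l = 1)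
    (h01 : ∀ i j, A i j = 0 ∨ A i j = 1)
    (hAdef : ∀ i j, A i j = 1 ↔
      (t : ℝ) ≤ (∑ l, b i l * b j l) - (∑ l, c i l * c j l)) :
    ∀ ε > (0 : ℝ),
      ∃ (V : Matrix (Fin n) (Fin (kb + kc + 1)) ℝ)
        (W : Matrix (Fin (kb + kc + 1)) (Fin (kb + kc + 1)) ℝ),
        (∀ i j, V i j ∈ Set.Icc (0 : ℝ) 1) ∧ W.IsDiag ∧
        Real.sqrt (∑ i, ∑ j,
          (1 / (1 + Real.exp (-((V * W * Vᵀ) i j))) - A i j) ^ 2) < ε := by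
  intro ε hε
  let z : Fin n → Fin n → ℝ := fun i j =>
    (∑ l, b i l * b j l) - (∑ l, c i l * c j l) + (1 / 2 - t)
  have hlim : ∀ i j, Filter.Tendsto (fun s : ℝ => 1 / (1 + Real.exp (-(s * z i j))))
      Filter.atTop (nhds (A i j)) := by
    intro i j
    obtain ⟨p, hp⟩ := exists_int_sum_mul_eq (hb i) (hb j)
    obtain ⟨q, hq⟩ := exists_int_sum_mul_eq (hc i) (hc j)
    have hij := hAdef i j
    have hz : z i j = (p : ℝ) - q + (1 / 2 - t) := by simp only [z, hp, hq]
    rw [← hp, ← hq] at hij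
    rcases h01 i j with h | h
    · rw [h] at hij ⊢
      have hlt : (p : ℝ) - q < t := by
        by_contra hle
        exact zero_ne_one (hij.mpr (not_lt.mp hle))
      have hint : p - q + 1 ≤ t := Int.add_one_le_of_lt (by exact_mod_cast hlt)
      have hreal : (p : ℝ) - q + 1 ≤ t := by exact_mod_cast hint
      exact tendsto_logistic_mul_of_neg (by rw [hz]; linarith)
    · have hle := hij.mp h
      rw [h]
      exact tendsto_logistic_mul_of_pos (by rw [hz]; linarith)
  have hnorm : Filter.Tendsto (fun s : ℝ => Real.sqrt (∑ i, ∑ j,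
      (1 / (1 + Real.exp (-(s * z i j))) - A i j) ^ 2)) Filter.atTop (nhds 0) := by
    have h := (tendsto_finsetSum Finset.univ fun i _ =>
      tendsto_finsetSum Finset.univ fun j _ => ((hlim i j).sub_const (A i j)).pow 2).sqrt
    simpa using h
  obtain ⟨s, hs⟩ := (hnorm.eventually_lt_const hε).exists
  let V : Matrix (Fin n) (Fin (kb + kc + 1)) ℝ := fun i =>
    Fin.snoc (α := fun _ => ℝ) (Fin.append (b i) (c i)) 1
  let W : Matrix (Fin (kb + kc + 1)) (Fin (kb + kc + 1)) ℝ :=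
    Matrix.diagonal fun l => s * Fin.snoc (α := fun _ => ℝ)
      (Fin.append (fun _ : Fin kb => (1 : ℝ)) (fun _ : Fin kc => -1)) (1 / 2 - t) l
  refine ⟨V, W, ?_, Matrix.isDiag_diagonal _, ?_⟩
  · intro i l
    refine Fin.lastCases ?_ (fun l => ?_) l
    · simp [V]
    · simp only [V]
      rw [Fin.snoc_castSucc]
      refine Fin.addCases (fun l => ?_) (fun l => ?_) l
      · rcases hb i l with h | h <;> simp [h]
      · rcases hc i l with h | h <;> simp [h]
  · have hVW : ∀ i j, (V * W * Vᵀ) i j = s * z i j := by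
      intro i j
      rw [Matrix.mul_apply]
      simp only [W, Matrix.mul_diagonal, Matrix.transpose_apply]
      simp only [V, Fin.sum_univ_castSucc, Fin.sum_univ_add, Fin.snoc_castSucc, Fin.snoc_last,
        Fin.append_left, Fin.append_right, z, mul_add, Finset.mul_sum, sub_eq_add_neg,
        ← Finset.sum_neg_distrib]
      congr 1
      · congr 1 <;> exact Finset.sum_congr rfl fun l _ => by ring
      · ring
    simpa only [hVW] using hs
end

section
/- Suppose the adjacency matrix A ∈ {0,1}^{n×n} is determined by binary vectors b_i ∈ {0,1}^{k_b} and c_i ∈ {0,1}^{k_c} for each vertex i and a thresholding integer t ∈ ℤ, via A_{ij} = 1 if and only if b_i · b_j − c_i · c_j ≥ t. Let k = k_b + k_c. Then there exist a matrix V ∈ [0,1]^{n×(k+1)} and a diagonal matrix W ∈ ℝ^{(k+1)×(k+1)} such that for all i, j: (V W Vᵀ)_{ij} = b_i · b_j − c_i · c_j + 1/2 − t; in particular (V W Vᵀ)_{ij} > 0 if and only if A_{ij} = 1, and (V W Vᵀ)_{ij} < 0 if and only if A_{ij} = 0. -/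
open Matrix

/-- The dot product of two binary vectors is an integer. -/
lemma exists_int_eq_sum_mul_of_binary {ι : Type*} [Fintype ι] {x y : ι → ℝ}
    (hx : ∀ l, x l = 0 ∨ x l = 1) (hy : ∀ l, y l = 0 ∨ y l = 1) :
    ∃ m : ℤ, ∑ l, x l * y l = m := by
  have h : ∀ l, ∃ m : ℤ, x l * y l = m := fun l => by
    rcases hx l with h | h
    · exact ⟨0, by simp [h]⟩
    · rcases hy l with h' | h'
      · exact ⟨0, by simp [h']⟩
      · exact ⟨1, by simp [h, h']⟩
  choose f hf using h
  exact ⟨∑ l, f l, by simp [hf]⟩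

/-- Suppose `A ∈ {0,1}^{n×n}` is determined by binary vectors `b_i ∈ {0,1}^{k_b}`,
`c_i ∈ {0,1}^{k_c}` and a threshold `t ∈ ℤ` via `A_{ij} = 1 ↔ b_i·b_j − c_i·c_j ≥ t`.
With `k = k_b + k_c`, there exist `V ∈ [0,1]^{n×(k+1)}` and a diagonal
`W ∈ ℝ^{(k+1)×(k+1)}` such that `(V W Vᵀ)_{ij} = b_i·b_j − c_i·c_j + 1/2 − t`; in
particular `(V W Vᵀ)_{ij} > 0 ↔ A_{ij} = 1` and `(V W Vᵀ)_{ij} < 0 ↔ A_{ij} = 0`. -/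
theorem thresholded_clustering_exact_logits (n kb kc : ℕ) (t : ℤ)
    (A : Matrix (Fin n) (Fin n) ℝ)
    (b : Fin n → Fin kb → ℝ) (c : Fin n → Fin kc → ℝ)
    (hb : ∀ i l, b i l = 0 ∨ b i l = 1) (hc : ∀ i l, c i l = 0 ∨ c i l = 1)
    (h01 : ∀ i j, A i j = 0 ∨ A i j = 1)
    (hAdef : ∀ i j, A i j = 1 ↔
      (t : ℝ) ≤ (∑ l, b i l * b j l) - (∑ l, c i l * c j l)) :
    ∃ (V : Matrix (Fin n) (Fin (kb + kc + 1)) ℝ)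
      (W : Matrix (Fin (kb + kc + 1)) (Fin (kb + kc + 1)) ℝ),
      (∀ i j, V i j ∈ Set.Icc (0 : ℝ) 1) ∧ W.IsDiag ∧
      ∀ i j,
        (V * W * Vᵀ) i j
          = (∑ l, b i l * b j l) - (∑ l, c i l * c j l) + 1 / 2 - (t : ℝ) ∧
        (0 < (V * W * Vᵀ) i j ↔ A i j = 1) ∧
        ((V * W * Vᵀ) i j < 0 ↔ A i j = 0) := by
  let V : Matrix (Fin n) (Fin (kb + kc + 1)) ℝ :=
    Matrix.of fun i => Fin.snoc (α := fun _ => ℝ) (Fin.append (b i) (c i)) 1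
  let w : Fin (kb + kc + 1) → ℝ :=
    Fin.snoc (α := fun _ => ℝ) (Fin.append (fun _ => 1) (fun _ => -1)) (1 / 2 - (t : ℝ))
  have hV : ∀ i j, (V * diagonal w * Vᵀ) i j
      = (∑ l, b i l * b j l) - (∑ l, c i l * c j l) + 1 / 2 - (t : ℝ) := by
    intro i j
    rw [mul_apply]
    simp only [mul_diagonal, transpose_apply, Fin.sum_univ_castSucc,
      Fin.sum_univ_add, V, w, of_apply, Fin.snoc_castSucc, Fin.snoc_last,
      Fin.append_left, Fin.append_right, mul_one, one_mul, mul_neg, neg_mul,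
      Finset.sum_neg_distrib]
    ring
  refine ⟨V, diagonal w, fun i j => ?_, isDiag_diagonal w, fun i j => ⟨hV i j, ?_⟩⟩
  · have hbin : V i j = 0 ∨ V i j = 1 := by
      induction j using Fin.lastCases with
      | last => simp [V]
      | cast j =>
        induction j using Fin.addCases with
        | left l => simpa only [V, of_apply, Fin.snoc_castSucc, Fin.append_left] using hb i l
        | right l => simpa only [V, of_apply, Fin.snoc_castSucc, Fin.append_right] using hc i l
    rcases hbin with h | h <;> simp [h]
  · obtain ⟨p, hp⟩ := exists_int_eq_sum_mul_of_binary (hb i) (hb j)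
    obtain ⟨q, hq⟩ := exists_int_eq_sum_mul_of_binary (hc i) (hc j)
    have hA0 : A i j = 0 ↔ ¬ A i j = 1 := by
      rcases h01 i j with h | h <;> simp [h]
    rw [hA0, hAdef, hV, hp, hq]
    rcases le_or_gt t (p - q) with h | h
    · have h' : (t : ℝ) ≤ p - q := by exact_mod_cast h
      exact ⟨⟨fun _ => h', fun _ => by linarith⟩,
        ⟨fun _ => by linarith, fun hn => absurd h' hn⟩⟩
    · have h' : (p : ℝ) - q + 1 ≤ t := by exact_mod_cast Int.add_one_le_iff.mpr h
      exact ⟨⟨fun _ => by linarith, fun _ => by linarith⟩,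
        ⟨fun _ hn => by linarith, fun _ => by linarith⟩⟩
end
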